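/- Let m ≥ 2 and let P^T be the transition matrix of the traditional unbiased random walk on the rose graph R_m^4 with N_m = 3m + 1 vertices, i.e., P^T(i,j) = a_{ij}/d_i. Suppose T : V × V → ℝ satisfies T(j,j) = 0 for every vertex j and T(i,j) = 1 + Σ_k P^T(i,k)·T(k,j) for all vertices i ≠ j (the first-step equations for mean hitting times). Then the global mean hitting time equals ⟨T⟩^T = (1/(N_m(N_m − 1)))·Σ_{i} Σ_{j} T(i,j) = 20m(3m − 1)/(3(3m + 1)). -/

import Mathlib

open Finset
/-- Adjacency matrix of the rose graph `R_m^4` on `3m+1` vertices: vertex `0` is the hub;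
for each petal `p`, vertices `3p+1`, `3p+2` are internal and `3p+3` is peripheral, with
edges `{0,3p+1}`, `{0,3p+2}`, `{3p+1,3p+3}`, `{3p+2,3p+3}`. -/
noncomputable def roseA (m : ℕ) : Matrix (Fin (3 * m + 1)) (Fin (3 * m + 1)) ℝ :=
  fun i j =>
    if ((i : ℕ) = 0 ∧ (j : ℕ) % 3 ≠ 0) ∨ ((j : ℕ) = 0 ∧ (i : ℕ) % 3 ≠ 0)
        ∨ ((i : ℕ) % 3 = 1 ∧ (j : ℕ) = (i : ℕ) + 2)
        ∨ ((i : ℕ) % 3 = 2 ∧ (j : ℕ) = (i : ℕ) + 1)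
        ∨ ((j : ℕ) % 3 = 1 ∧ (i : ℕ) = (j : ℕ) + 2)
        ∨ ((j : ℕ) % 3 = 2 ∧ (i : ℕ) = (j : ℕ) + 1)
    then 1 else 0
/-- Transition matrix of the traditional unbiased random walk (TURW) on the rose graph
`R_m^4`: from each vertex the walker moves to each neighbor with probability `1/dᵢ`. -/
noncomputable def rosePT (m : ℕ) : Matrix (Fin (3 * m + 1)) (Fin (3 * m + 1)) ℝ :=
  fun i j => roseA m i j / ∑ k, roseA m i k

/-- The vertex `3p + r + 1` of the petal `p`: internal for `r = 0, 1`, peripheral for `r = 2`. -/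
def petalVertex {m : ℕ} (p : Fin m) (r : Fin 3) : Fin (3 * m + 1) :=
  ⟨3 * p + r + 1, by omega⟩

lemma petalVertex_ne_zero {m : ℕ} (p : Fin m) (r : Fin 3) : petalVertex p r ≠ 0 :=
  Fin.ne_of_val_ne (Nat.succ_ne_zero _)

lemma petalVertex_inj {m : ℕ} {p q : Fin m} {r s : Fin 3} :
    petalVertex p r = petalVertex q s ↔ p = q ∧ r = s := by
  simp only [petalVertex, Fin.ext_iff]
  omega

lemma sum_rose_vertices {M : Type*} [AddCommMonoid M] {m : ℕ} (f : Fin (3 * m + 1) → M) :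
    ∑ i, f i = f 0 + ∑ p : Fin m, (f (petalVertex p 0) + f (petalVertex p 1)
      + f (petalVertex p 2)) := by
  have h : ∑ i : Fin (3 * m), f i.succ = ∑ x : Fin m × Fin 3, f (petalVertex x.1 x.2) := by
    refine (Fintype.sum_equiv (finProdFinEquiv.trans (finCongr (mul_comm m 3))) _ _ ?_).symm
    rintro ⟨p, r⟩
    congr 1
    simp [petalVertex, Fin.ext_iff, add_comm]
  simp only [Fin.sum_univ_succ f, h, Fintype.sum_prod_type, Fin.sum_univ_three]

lemma roseA_zero_zero (m : ℕ) : roseA m 0 0 = 0 := by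
  simp [roseA]

lemma roseA_zero_petalVertex {m : ℕ} (p : Fin m) (r : Fin 3) :
    roseA m 0 (petalVertex p r) = if r = 2 then 0 else 1 := by
  fin_cases r <;> simp [roseA, petalVertex] <;> omega

lemma roseA_petalVertex_zero {m : ℕ} (p : Fin m) (r : Fin 3) :
    roseA m (petalVertex p r) 0 = if r = 2 then 0 else 1 := by
  fin_cases r <;> simp [roseA, petalVertex] <;> omega

lemma roseA_petalVertex_petalVertex {m : ℕ} (p q : Fin m) (r s : Fin 3) :
    roseA m (petalVertex p r) (petalVertex q s)
      = if q = p then (if (r = 2) = (s = 2) then 0 else 1) else 0 := by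
  fin_cases r <;> fin_cases s <;> simp [roseA, petalVertex, Fin.ext_iff] <;>
    first | omega | exact if_congr (by omega) rfl rfl

lemma sum_roseA_zero_mul {m : ℕ} (f : Fin (3 * m + 1) → ℝ) :
    ∑ k, roseA m 0 k * f k = ∑ p : Fin m, (f (petalVertex p 0) + f (petalVertex p 1)) := by
  simp [sum_rose_vertices, roseA_zero_zero, roseA_zero_petalVertex]

lemma sum_roseA_internal_mul {m : ℕ} (f : Fin (3 * m + 1) → ℝ) (p : Fin m) {r : Fin 3}
    (hr : r ≠ 2) :
    ∑ k, roseA m (petalVertex p r) k * f k = f 0 + f (petalVertex p 2) := by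
  simp [sum_rose_vertices, roseA_petalVertex_zero, roseA_petalVertex_petalVertex, hr]

lemma sum_roseA_peripheral_mul {m : ℕ} (f : Fin (3 * m + 1) → ℝ) (p : Fin m) :
    ∑ k, roseA m (petalVertex p 2) k * f k = f (petalVertex p 0) + f (petalVertex p 1) := by
  simp [sum_rose_vertices, roseA_petalVertex_zero, roseA_petalVertex_petalVertex,
    Finset.sum_add_distrib]

lemma sum_rosePT_mul {m : ℕ} (i : Fin (3 * m + 1)) (f : Fin (3 * m + 1) → ℝ) :
    ∑ k, rosePT m i k * f k = (∑ k, roseA m i k * f k) / ∑ k, roseA m i k * 1 := by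
  simp only [rosePT, mul_one, Finset.sum_div, div_mul_eq_mul_div]

lemma sum_rosePT_zero_mul {m : ℕ} (f : Fin (3 * m + 1) → ℝ) :
    ∑ k, rosePT m 0 k * f k
      = (∑ p : Fin m, (f (petalVertex p 0) + f (petalVertex p 1))) / (2 * m) := by
  rw [sum_rosePT_mul, sum_roseA_zero_mul, sum_roseA_zero_mul (fun _ => 1)]
  congr 1
  simp
  ring

lemma sum_rosePT_internal_mul {m : ℕ} (f : Fin (3 * m + 1) → ℝ) (p : Fin m) {r : Fin 3}
    (hr : r ≠ 2) :
    ∑ k, rosePT m (petalVertex p r) k * f k = (f 0 + f (petalVertex p 2)) / 2 := by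
  rw [sum_rosePT_mul, sum_roseA_internal_mul f p hr, sum_roseA_internal_mul (fun _ => 1) p hr]
  norm_num

lemma sum_rosePT_peripheral_mul {m : ℕ} (f : Fin (3 * m + 1) → ℝ) (p : Fin m) :
    ∑ k, rosePT m (petalVertex p 2) k * f k
      = (f (petalVertex p 0) + f (petalVertex p 1)) / 2 := by
  rw [sum_rosePT_mul, sum_roseA_peripheral_mul f, sum_roseA_peripheral_mul (fun _ => 1)]
  norm_num

lemma Fintype.sum_eq_add_of_ne_eq {ι : Type*} [Fintype ι] (g : ι → ℝ) (p : ι) (c : ℝ)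
    (h : ∀ q, q ≠ p → g q = c) : ∑ q, g q = g p + (Fintype.card ι - 1) * c := by
  classical
  have hp : 1 ≤ Fintype.card ι := Fintype.card_pos_iff.mpr ⟨p⟩
  rw [← Finset.add_sum_erase _ g (Finset.mem_univ p),
    Finset.sum_congr rfl fun q hq => h q (Finset.ne_of_mem_erase hq)]
  simp [Finset.card_erase_of_mem, Nat.cast_sub hp]

section FirstStep

variable {m : ℕ} {f : Fin (3 * m + 1) → ℝ} {j : Fin (3 * m + 1)}

/-- In a petal that does not contain the target, hitting times exceed the one from the hub by
`3` at internal vertices and by `4` at the peripheral vertex. -/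
lemma hitting_petal_of_ne
    (hstep : ∀ i, i ≠ j → f i = 1 + ∑ k, rosePT m i k * f k) (q : Fin m)
    (hq : ∀ r, petalVertex q r ≠ j) :
    f (petalVertex q 0) = f 0 + 3 ∧ f (petalVertex q 1) = f 0 + 3 ∧
      f (petalVertex q 2) = f 0 + 4 := by
  have h0 := hstep _ (hq 0)
  have h1 := hstep _ (hq 1)
  have h2 := hstep _ (hq 2)
  rw [sum_rosePT_internal_mul f q (by decide)] at h0 h1
  rw [sum_rosePT_peripheral_mul] at h2
  refine ⟨?_, ?_, ?_⟩ <;> linarith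

lemma sum_hitting_zero (hzero : f 0 = 0)
    (hstep : ∀ i, i ≠ 0 → f i = 1 + ∑ k, rosePT m i k * f k) :
    ∑ i, f i = 10 * m := by
  have h (q : Fin m) := hitting_petal_of_ne hstep q fun r => petalVertex_ne_zero q r
  rw [sum_rose_vertices]
  simp only [(h _).1, (h _).2.1, (h _).2.2, hzero]
  simp
  ring

/-- The first-step equation at the hub, with the petals avoiding the target eliminated. -/
lemma hitting_zero_eq {p : Fin m} {r : Fin 3}
    (hstep : ∀ i, i ≠ petalVertex p r → f i = 1 + ∑ k, rosePT m i k * f k) :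
    2 * f 0 = 8 * m - 6 + f (petalVertex p 0) + f (petalVertex p 1) := by
  have hm : (m : ℝ) ≠ 0 := Nat.cast_ne_zero.mpr (Fin.pos p).ne'
  have h := hstep 0 (petalVertex_ne_zero p r).symm
  rw [sum_rosePT_zero_mul, Fintype.sum_eq_add_of_ne_eq _ p (2 * f 0 + 6), Fintype.card_fin] at h
  · field_simp at h
    linarith
  · intro q hq
    have := hitting_petal_of_ne hstep q fun s hs => hq (petalVertex_inj.mp hs).1
    linarith

lemma sum_hitting_eq {p : Fin m} {r : Fin 3}
    (hstep : ∀ i, i ≠ petalVertex p r → f i = 1 + ∑ k, rosePT m i k * f k) :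
    ∑ i, f i = f 0 + (f (petalVertex p 0) + f (petalVertex p 1) + f (petalVertex p 2))
      + (m - 1) * (3 * f 0 + 10) := by
  rw [sum_rose_vertices, Fintype.sum_eq_add_of_ne_eq _ p (3 * f 0 + 10), Fintype.card_fin]
  · ring
  intro q hq
  have := hitting_petal_of_ne hstep q fun s hs => hq (petalVertex_inj.mp hs).1
  linarith

lemma sum_hitting_internal {p : Fin m} {r : Fin 3} (hr : r ≠ 2)
    (hzero : f (petalVertex p r) = 0)
    (hstep : ∀ i, i ≠ petalVertex p r → f i = 1 + ∑ k, rosePT m i k * f k) :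
    ∑ i, f i = 18 * m ^ 2 - 5 * m - 3 := by
  have hhub := hitting_zero_eq hstep
  have h2 := hstep (petalVertex p 2) fun h => hr (petalVertex_inj.mp h).2.symm
  rw [sum_rosePT_peripheral_mul] at h2
  have hint (s : Fin 3) (hs : s ≠ 2) (hsr : s ≠ r) :=
    (hstep (petalVertex p s) fun h => hsr (petalVertex_inj.mp h).2).trans
      (congrArg (1 + ·) (sum_rosePT_internal_mul f p hs))
  have hf : f 0 = 6 * m - 3 ∧
      f (petalVertex p 0) + f (petalVertex p 1) + f (petalVertex p 2) = 6 * m + 1 := by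
    obtain rfl | rfl : r = 0 ∨ r = 1 := by omega
    · have := hint 1 (by decide) (by decide)
      constructor <;> linarith
    · have := hint 0 (by decide) (by decide)
      constructor <;> linarith
  rw [sum_hitting_eq hstep, hf.1, hf.2]
  ring

lemma sum_hitting_peripheral {p : Fin m} (hzero : f (petalVertex p 2) = 0)
    (hstep : ∀ i, i ≠ petalVertex p 2 → f i = 1 + ∑ k, rosePT m i k * f k) :
    ∑ i, f i = 24 * m ^ 2 - 10 * m - 4 := by
  have hhub := hitting_zero_eq hstep
  have hint (s : Fin 3) (hs : s ≠ 2) :=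
    (hstep (petalVertex p s) fun h => hs (petalVertex_inj.mp h).2).trans
      (congrArg (1 + ·) (sum_rosePT_internal_mul f p hs))
  have h0 := hint 0 (by decide)
  have h1 := hint 1 (by decide)
  have hf : f 0 = 8 * m - 4 := by linarith
  have hp : f (petalVertex p 0) + f (petalVertex p 1) + f (petalVertex p 2) = 8 * m - 2 := by
    linarith
  rw [sum_hitting_eq hstep, hf, hp]
  ring

end FirstStep

/-- Global mean hitting time of the TURW on the rose graph `R_m^4` with `N_m = 3m+1`
vertices: `⟨T⟩ = 20m(3m-1)/(3(3m+1))`. -/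
theorem rose_turw_global_mean_hitting (m : ℕ) (hm : 2 ≤ m)
    (T : Fin (3 * m + 1) → Fin (3 * m + 1) → ℝ)
    (hdiag : ∀ j, T j j = 0)
    (hstep : ∀ i j : Fin (3 * m + 1), i ≠ j →
      T i j = 1 + ∑ k, rosePT m i k * T k j) :
    (1 / ((3 * (m : ℝ) + 1) * (3 * (m : ℝ)))) * ∑ i, ∑ j, T i j
      = 20 * (m : ℝ) * (3 * (m : ℝ) - 1) / (3 * (3 * (m : ℝ) + 1)) := by
  have hm0 : (m : ℝ) ≠ 0 := Nat.cast_ne_zero.mpr (by omega)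
  have hinternal (p : Fin m) (r : Fin 3) (hr : r ≠ 2) :=
    sum_hitting_internal (f := fun i => T i (petalVertex p r)) hr (hdiag _) fun i => hstep i _
  have hperipheral (p : Fin m) :=
    sum_hitting_peripheral (f := fun i => T i (petalVertex p 2)) (hdiag _) fun i => hstep i _
  have hsum : ∑ i, ∑ j, T i j = 20 * (m : ℝ) ^ 2 * (3 * m - 1) := by
    rw [Finset.sum_comm, sum_rose_vertices,
      sum_hitting_zero (f := fun i => T i 0) (hdiag 0) fun i => hstep i 0]
    simp only [hinternal _ 0 (by decide), hinternal _ 1 (by decide), hperipheral,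
      Finset.sum_const, Finset.card_univ, Fintype.card_fin, nsmul_eq_mul]
    ring
  rw [hsum]
  field_simp
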